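/- The modular expressions for the genus-zero correlation functions of ℙ¹_{2,2,2,2} satisfy the WDVV system: set A(τ) = θ₃(2τ)², C(τ) = θ₂(2τ)², E(τ) = (E₂(τ) − 2E₂(2τ) + 4E₂(4τ))/3, and define X(τ) = (1/4)A(τ)C(τ), Y(τ) = (1/8)(−3E(τ) + A(τ)² − 2C(τ)²), Z(τ) = (1/8)(−E(τ) + A(τ)²). Then for every τ in the complex upper half-plane, with D denoting the operator (1/2πi)·d/dτ, one has 2·DX = 4X(Z − Y), 2·DY = 12Z² − 4X² − 8YZ, and 2·DZ = 4X² − 4Z². -/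

import Mathlib

noncomputable def theta2 (τ : ℂ) : ℂ :=
  ∑' n : ℤ, Complex.exp (Real.pi * Complex.I * ((n : ℂ) + 1/2)^2 * τ)

noncomputable def theta3 (τ : ℂ) : ℂ :=
  ∑' n : ℤ, Complex.exp (Real.pi * Complex.I * (n : ℂ)^2 * τ)

noncomputable def theta4 (τ : ℂ) : ℂ :=
  ∑' n : ℤ, (-1 : ℂ)^n * Complex.exp (Real.pi * Complex.I * (n : ℂ)^2 * τ)
noncomputable def E2 (τ : ℂ) : ℂ :=
  1 - 24 * ∑' n : ℕ, (∑ d ∈ Nat.divisors (n + 1), (d : ℂ)) *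
    Complex.exp (2 * Real.pi * Complex.I * ((n : ℂ) + 1) * τ)

noncomputable def Aform (τ : ℂ) : ℂ := theta3 (2 * τ) ^ 2

noncomputable def Cform (τ : ℂ) : ℂ := theta2 (2 * τ) ^ 2

noncomputable def Eform (τ : ℂ) : ℂ := (E2 τ - 2 * E2 (2 * τ) + 4 * E2 (4 * τ)) / 3

noncomputable def Xcorr (τ : ℂ) : ℂ := (1 / 4) * Aform τ * Cform τ

noncomputable def Ycorr (τ : ℂ) : ℂ :=
  (1 / 8) * (-3 * Eform τ + Aform τ ^ 2 - 2 * Cform τ ^ 2)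

noncomputable def Zcorr (τ : ℂ) : ℂ := (1 / 8) * (-(Eform τ) + Aform τ ^ 2)

section

open Filter Topology UpperHalfPlane SlashInvariantForm MatrixGroups ModularForm

/-- A cusp form of level one and weight less than `12`, presented as a function on `ℂ`,
vanishes on the upper half-plane. -/
lemma levelOne_eq_zero_of_tendsto_zero {f : ℂ → ℂ} {k : ℤ} (hk : k < 12)
    (hd : ∀ z : ℂ, 0 < z.im → DifferentiableAt ℂ f z)
    (hT : ∀ z : ℂ, 0 < z.im → f (z + 1) = f z)
    (hS : ∀ z : ℂ, 0 < z.im → f (-1 / z) = z ^ k * f z)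
    (h0 : Tendsto f (comap Complex.im atTop) (𝓝 0)) (z : ℂ) (hz : 0 < z.im) : f z = 0 := by
  set F : ℍ → ℂ := fun w ↦ f w
  have hFS : F ∣[k] ModularGroup.S = F := by
    ext w
    rw [slash_S_apply]
    have h := hS w w.im_pos
    rw [show -1 / (w : ℂ) = (-(w : ℂ))⁻¹ by rw [inv_neg, neg_div, one_div]] at h
    simp only [F]
    rw [h, mul_comm, ← mul_assoc, ← zpow_add₀ w.ne_zero]
    simp
  have hFT : F ∣[k] ModularGroup.T = F := by
    ext w
    have hden : denom (ModularGroup.T : GL (Fin 2) ℝ) w = 1 := by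
      simp [denom, ModularGroup.coe_T]
    rw [SL_slash_apply, modular_T_smul, hden]
    simpa [F, add_comm] using hT w w.im_pos
  have hFz : IsZeroAtImInfty F := h0.comp tendsto_coe_atImInfty
  let G : CuspForm 𝒮ℒ k :=
    { toFun := F
      slash_action_eq' := by
        rintro A ⟨A, rfl⟩
        exact slash_action_generators_SL2Z hFS hFT A
      holo' := by
        rw [UpperHalfPlane.mdifferentiable_iff]
        refine .congr (fun w hw ↦ (hd w hw).differentiableWithinAt) fun w hw ↦ ?_
        simp [F, ofComplex_apply_of_im_pos hw]
      zero_at_cusps' := by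
        intro c hc
        rw [Subgroup.IsArithmetic.isCusp_iff_isCusp_SL2Z] at hc
        rw [OnePoint.isZeroAt_iff_forall_SL2Z hc]
        intro γ _
        rw [slash_action_generators_SL2Z hFS hFT]
        exact hFz }
  have hG : G = 0 := rank_zero_iff_forall_zero.mp (CuspForm.rank_eq_zero_of_weight_lt_twelve hk) G
  exact DFunLike.congr_fun hG ⟨z, hz⟩

lemma E2_eq_eisensteinSeries_E2 (z : ℍ) : E2 z = EisensteinSeries.E2 z := by
  rw [EisensteinSeries.E2_eq_tsum_cexp,
    tsum_pnat_eq_tsum_succ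
      (f := fun n : ℕ ↦ (ArithmeticFunction.sigma 1 n : ℂ) *
        Complex.exp (2 * Real.pi * Complex.I * z) ^ n), E2]
  congr 2
  refine tsum_congr fun n ↦ ?_
  rw [ArithmeticFunction.sigma_one_apply, ← Complex.exp_nat_mul]
  push_cast
  ring_nf

lemma E2_differentiableAt {z : ℂ} (hz : 0 < z.im) : DifferentiableAt ℂ E2 z := by
  have h := UpperHalfPlane.mdifferentiable_iff.mp E2_mdifferentiable
  refine ((h.congr fun w hw ↦ ?_).differentiableAt (isOpen_upperHalfPlaneSet.mem_nhds hz))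
  simpa [ofComplex_apply_of_im_pos hw] using E2_eq_eisensteinSeries_E2 ⟨w, hw⟩

lemma E2_add_one (z : ℂ) : E2 (z + 1) = E2 z := by
  unfold E2
  congr 3
  ext n
  congr 1
  rw [Complex.exp_eq_exp_iff_exists_int]
  exact ⟨n + 1, by push_cast; ring⟩

lemma E2_neg_one_div {z : ℂ} (hz : 0 < z.im) :
    E2 (-1 / z) = z ^ 2 * E2 z + 6 / (Real.pi * Complex.I) * z := by
  have hz0 : z ≠ 0 := by rintro rfl; simp at hz
  have h := congrFun (EisensteinSeries.E2_slash_action ModularGroup.S) ⟨z, hz⟩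
  rw [slash_S_apply] at h
  simp only [Pi.sub_apply, Pi.smul_apply, EisensteinSeries.D2_S, ← E2_eq_eisensteinSeries_E2,
    riemannZeta_two, smul_eq_mul] at h
  rw [show -1 / z = (-z)⁻¹ by rw [inv_neg, neg_div, one_div]]
  have hp : (Real.pi : ℂ) ≠ 0 := by exact_mod_cast Real.pi_ne_zero
  have hI := Complex.I_ne_zero
  have h2 : E2 (-z)⁻¹ = z ^ 2 * (E2 (-z)⁻¹ * z ^ (-2 : ℤ)) := by
    rw [zpow_neg]; field_simp
  rw [h2, h]
  field_simp
  linear_combination (-6 : ℂ) * Complex.I_sq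

lemma norm_cexp_pi_mul_I (c : ℝ) (z : ℂ) :
    ‖Complex.exp (Real.pi * Complex.I * c * z)‖ = Real.exp (-(Real.pi * c * z.im)) := by
  rw [Complex.norm_exp]
  simp [mul_assoc]

lemma cexp_tendsto_zero {c : ℝ} (hc : 0 < c) :
    Tendsto (fun z : ℂ ↦ Complex.exp (Real.pi * Complex.I * c * z)) (comap Complex.im atTop)
      (𝓝 0) := by
  rw [tendsto_zero_iff_norm_tendsto_zero]
  simp_rw [norm_cexp_pi_mul_I]
  exact Real.tendsto_exp_neg_atTop_nhds_zero.comp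
    (tendsto_comap.const_mul_atTop (mul_pos Real.pi_pos hc))

lemma E2_tendsto_one : Tendsto E2 (comap Complex.im atTop) (𝓝 1) := by
  suffices h : Tendsto (fun z : ℂ ↦ ∑' n : ℕ, (∑ d ∈ Nat.divisors (n + 1), (d : ℂ)) *
      Complex.exp (2 * Real.pi * Complex.I * ((n : ℂ) + 1) * z)) (comap Complex.im atTop)
      (𝓝 (∑' _ : ℕ, 0)) by
    have := (h.const_mul 24).const_sub 1
    simp only [tsum_zero, mul_zero, sub_zero] at this
    exact this
  have hs := ((summable_nat_add_iff 1).mpr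
    (EisensteinSeries.summable_sigma_mul_cexp_pow (k := 2) one_le_two I)).norm
  have he (n : ℕ) (z : ℂ) : Complex.exp (2 * Real.pi * Complex.I * ((n : ℂ) + 1) * z) =
      Complex.exp (Real.pi * Complex.I * (2 * (n + 1) : ℝ) * z) := by
    push_cast
    ring_nf
  refine tendsto_tsum_of_dominated_convergence hs (fun n ↦ ?_) ?_
  · simp_rw [he]
    simpa using (cexp_tendsto_zero (c := 2 * (n + 1)) (by positivity)).const_mul
      (∑ d ∈ Nat.divisors (n + 1), (d : ℂ))
  · filter_upwards [preimage_mem_comap (Ici_mem_atTop (1 : ℝ))] with z hz n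
    rw [he, norm_mul, norm_mul, norm_cexp_pi_mul_I]
    gcongr
    · simp [ArithmeticFunction.sigma_one_apply]
    · rw [← Complex.exp_nat_mul, show ((n + 1 : ℕ) : ℂ) * (2 * Real.pi * Complex.I * (I : ℍ)) =
        Real.pi * Complex.I * (2 * (n + 1) : ℝ) * Complex.I by push_cast; ring,
        norm_cexp_pi_mul_I, Real.exp_le_exp, neg_le_neg_iff]
      gcongr
      simpa using hz

lemma theta3_eq_jacobiTheta₂ (τ : ℂ) : theta3 τ = jacobiTheta₂ 0 τ :=
  tsum_congr fun n ↦ by simp [jacobiTheta₂_term]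

lemma theta4_eq_jacobiTheta₂ (τ : ℂ) : theta4 τ = jacobiTheta₂ (1 / 2) τ := by
  refine tsum_congr fun n ↦ ?_
  rw [jacobiTheta₂_term, Complex.exp_add]
  congr 1
  rw [show 2 * (Real.pi : ℂ) * Complex.I * n * (1 / 2) = n * (Real.pi * Complex.I) by ring,
    Complex.exp_int_mul, Complex.exp_pi_mul_I]

lemma theta2_eq_jacobiTheta₂ (τ : ℂ) :
    theta2 τ = Complex.exp (Real.pi * Complex.I * τ / 4) * jacobiTheta₂ (τ / 2) τ := by
  rw [theta2, jacobiTheta₂, ← tsum_mul_left]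
  refine tsum_congr fun n ↦ ?_
  rw [jacobiTheta₂_term, ← Complex.exp_add]
  ring_nf

lemma theta2_summable {τ : ℂ} (hτ : 0 < τ.im) :
    Summable fun n : ℤ ↦ Complex.exp (Real.pi * Complex.I * ((n : ℂ) + 1/2)^2 * τ) := by
  refine (((summable_jacobiTheta₂_term_iff (τ / 2) τ).mpr hτ).mul_left
    (Complex.exp (Real.pi * Complex.I * τ / 4))).congr fun n ↦ ?_
  rw [jacobiTheta₂_term, ← Complex.exp_add]
  ring_nf

lemma theta3_summable {τ : ℂ} (hτ : 0 < τ.im) :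
    Summable fun n : ℤ ↦ Complex.exp (Real.pi * Complex.I * (n : ℂ)^2 * τ) :=
  ((summable_jacobiTheta₂_term_iff 0 τ).mpr hτ).congr fun n ↦ by simp [jacobiTheta₂_term]

lemma theta2_differentiableAt {z : ℂ} (hz : 0 < z.im) : DifferentiableAt ℂ theta2 z := by
  rw [funext theta2_eq_jacobiTheta₂]
  refine DifferentiableAt.mul (by fun_prop) ?_
  exact (hasFDerivAt_jacobiTheta₂ (z / 2) hz).differentiableAt.comp z
    (f := fun τ : ℂ ↦ (τ / 2, τ)) (by fun_prop)

lemma theta3_differentiableAt {z : ℂ} (hz : 0 < z.im) : DifferentiableAt ℂ theta3 z := by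
  rw [funext theta3_eq_jacobiTheta₂]
  exact differentiableAt_jacobiTheta₂_snd 0 hz

lemma theta4_differentiableAt {z : ℂ} (hz : 0 < z.im) : DifferentiableAt ℂ theta4 z := by
  rw [funext theta4_eq_jacobiTheta₂]
  exact differentiableAt_jacobiTheta₂_snd _ hz

lemma theta3_add_one (z : ℂ) : theta3 (z + 1) = theta4 z := by
  refine tsum_congr fun n ↦ ?_
  rw [mul_add, Complex.exp_add, mul_comm]
  congr 1
  rw [show (Real.pi : ℂ) * Complex.I * (n : ℂ) ^ 2 * 1 = (n ^ 2 : ℤ) * (Real.pi * Complex.I) by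
    push_cast; ring, Complex.exp_int_mul, Complex.exp_pi_mul_I]
  rcases Int.even_or_odd n with h | h
  · rw [h.neg_one_zpow, (h.pow_of_ne_zero two_ne_zero).neg_one_zpow]
  · rw [h.neg_one_zpow, h.pow.neg_one_zpow]

lemma theta4_add_one (z : ℂ) : theta4 (z + 1) = theta3 z := by
  rw [← theta3_add_one, theta3_eq_jacobiTheta₂, show z + 1 + 1 = z + 2 by ring,
    jacobiTheta₂_add_right, ← theta3_eq_jacobiTheta₂]

lemma theta2_add_one_pow_four (z : ℂ) : theta2 (z + 1) ^ 4 = -theta2 z ^ 4 := by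
  have h : theta2 (z + 1) = Complex.exp (Real.pi * Complex.I / 4) * theta2 z := by
    rw [theta2, theta2, ← tsum_mul_left]
    refine tsum_congr fun n ↦ ?_
    rw [← Complex.exp_add, Complex.exp_eq_exp_iff_exists_int]
    obtain ⟨m, hm⟩ := Int.even_mul_succ_self n
    refine ⟨m, ?_⟩
    have : (n : ℂ) * (n + 1) = m + m := by exact_mod_cast hm
    linear_combination Real.pi * Complex.I * this
  rw [h, mul_pow, ← Complex.exp_nat_mul,
    show ((4 : ℕ) : ℂ) * (Real.pi * Complex.I / 4) = Real.pi * Complex.I by push_cast; ring,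
    Complex.exp_pi_mul_I]
  ring

lemma cpow_half_pow_four {z : ℂ} : ((-Complex.I * z) ^ (1 / 2 : ℂ)) ^ 4 = -z ^ 2 := by
  rw [← Complex.cpow_nat_mul, show ((4 : ℕ) : ℂ) * (1 / 2) = (2 : ℕ) by norm_num,
    Complex.cpow_natCast, mul_pow, neg_sq, Complex.I_sq]
  ring

lemma theta3_neg_one_div_pow_four {z : ℂ} (hz : 0 < z.im) :
    theta3 (-1 / z) ^ 4 = -z ^ 2 * theta3 z ^ 4 := by
  have hz0 : z ≠ 0 := by rintro rfl; simp at hz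
  have h := jacobiTheta₂_functional_equation 0 z
  simp only [ne_eq, OfNat.ofNat_ne_zero, not_false_eq_true, zero_pow, mul_zero, zero_div,
    Complex.exp_zero, mul_one] at h
  rw [theta3_eq_jacobiTheta₂, theta3_eq_jacobiTheta₂, h, mul_pow, div_pow, cpow_half_pow_four]
  field_simp

lemma theta2_neg_one_div_pow_four {z : ℂ} (hz : 0 < z.im) :
    theta2 (-1 / z) ^ 4 = -z ^ 2 * theta4 z ^ 4 := by
  have hz0 : z ≠ 0 := by rintro rfl; simp at hz
  have h := jacobiTheta₂_functional_equation (1 / 2) z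
  rw [theta2_eq_jacobiTheta₂, theta4_eq_jacobiTheta₂, h, mul_pow, mul_pow, mul_pow, div_pow,
    cpow_half_pow_four, show -1 / z / 2 = -(1 / 2 / z) by field_simp, jacobiTheta₂_neg_left]
  have : Complex.exp (Real.pi * Complex.I * (-1 / z) / 4) =
      Complex.exp (-Real.pi * Complex.I * (1 / 2) ^ 2 / z) := by
    congr 1; field_simp; norm_num
  rw [this]
  field_simp

lemma im_neg_one_div_pos {z : ℂ} (hz : 0 < z.im) : 0 < (-1 / z).im := by
  have := UpperHalfPlane.im_inv_neg_coe_pos ⟨z, hz⟩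
  rwa [show -1 / z = (-z)⁻¹ by rw [inv_neg, neg_div, one_div]]

lemma theta4_neg_one_div_pow_four {z : ℂ} (hz : 0 < z.im) :
    theta4 (-1 / z) ^ 4 = -z ^ 2 * theta2 z ^ 4 := by
  have hz0 : z ≠ 0 := by rintro rfl; simp at hz
  have h := theta2_neg_one_div_pow_four (im_neg_one_div_pos hz)
  rw [show -1 / (-1 / z) = z by field_simp] at h
  rw [h]
  field_simp

/-- Splitting a sum over `ℤ` by parity. -/
lemma tsum_int_even_add_odd {f : ℤ → ℂ} (hf : Summable f) :
    ∑' k : ℤ, f k = ∑' l : ℤ, f (2 * l) + ∑' l : ℤ, f (2 * l + 1) := by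
  have he : Function.Injective fun l : ℤ ↦ 2 * l := fun a b h ↦ by simpa using h
  have ho : Function.Injective fun l : ℤ ↦ 2 * l + 1 := fun a b h ↦ by simpa using h
  have h1 := he.hasSum_range_iff.mpr (hf.comp_injective he).hasSum
  have h2 := ho.hasSum_range_iff.mpr (hf.comp_injective ho).hasSum
  refine (h1.add_isCompl ?_ h2).tsum_eq
  have hE : (Set.range fun l : ℤ ↦ 2 * l) = {n | Even n} := by
    ext n; simp [even_iff_exists_two_mul]
  have hO : (Set.range fun l : ℤ ↦ 2 * l + 1) = {n | Odd n} := by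
    ext n; exact ⟨fun ⟨a, h⟩ ↦ ⟨a, h.symm⟩, fun ⟨a, h⟩ ↦ ⟨a, h.symm⟩⟩
  rw [hE, hO]
  exact Int.isCompl_even_odd

lemma theta3_div_four {z : ℂ} (hz : 0 < z.im) : theta3 (z / 4) = theta3 z + theta2 z := by
  have hz4 : 0 < (z / 4).im := by simpa using hz
  rw [theta3, tsum_int_even_add_odd (theta3_summable hz4), theta3, theta2]
  congr 1 <;> refine tsum_congr fun n ↦ ?_ <;> congr 1 <;> push_cast <;> ring

/-- The duplication formula `θ₂(τ)² = 2 θ₂(2τ) θ₃(2τ)`. -/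
lemma theta2_sq {z : ℂ} (hz : 0 < z.im) : theta2 z ^ 2 = 2 * theta2 (2 * z) * theta3 (2 * z) := by
  have hz2 : 0 < (2 * z).im := by simpa using hz
  set t : ℤ → ℂ := fun n ↦ Complex.exp (Real.pi * Complex.I * ((n : ℂ) + 1/2)^2 * z) with ht
  have hs : Summable t := theta2_summable hz
  have hprod : Summable fun p : ℤ × ℤ ↦ t p.1 * t p.2 :=
    summable_mul_of_summable_norm hs.norm hs.norm
  let e : ℤ × ℤ ≃ ℤ × ℤ :=
    { toFun := fun p ↦ (p.2, p.2 + p.1)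
      invFun := fun p ↦ (p.2 - p.1, p.1)
      left_inv := fun p ↦ by simp
      right_inv := fun p ↦ by simp }
  have hprod' : Summable fun p : ℤ × ℤ ↦ t p.2 * t (p.2 + p.1) := e.summable_iff.mpr hprod
  have hsum : theta2 z ^ 2 = ∑' k : ℤ, ∑' m : ℤ, t m * t (m + k) := by
    rw [← hprod'.tsum_prod, sq]
    exact (hs.tsum_mul_tsum hs hprod).trans (e.tsum_eq fun p : ℤ × ℤ ↦ t p.1 * t p.2).symm
  have heven (l : ℤ) : ∑' m : ℤ, t m * t (m + 2 * l) =
      theta2 (2 * z) * Complex.exp (Real.pi * Complex.I * (l : ℂ) ^ 2 * (2 * z)) := by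
    rw [theta2, ← tsum_mul_right, ← (Equiv.addRight (-l)).tsum_eq]
    refine tsum_congr fun m ↦ ?_
    simp only [ht, ← Complex.exp_add, Equiv.coe_addRight]
    congr 1; push_cast; ring
  have hodd (l : ℤ) : ∑' m : ℤ, t m * t (m + (2 * l + 1)) =
      theta3 (2 * z) * Complex.exp (Real.pi * Complex.I * ((l : ℂ) + 1 / 2) ^ 2 * (2 * z)) := by
    rw [theta3, ← tsum_mul_right, ← (Equiv.addRight (-(l + 1))).tsum_eq]
    refine tsum_congr fun m ↦ ?_
    simp only [ht, ← Complex.exp_add, Equiv.coe_addRight]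
    congr 1; push_cast; ring
  rw [hsum, tsum_int_even_add_odd hprod'.prod]
  simp_rw [heven, hodd, tsum_mul_left]
  rw [← theta2, ← theta3]
  ring

lemma theta3_tendsto_one : Tendsto theta3 (comap Complex.im atTop) (𝓝 1) := by
  have h0 : Tendsto (fun z : ℂ ↦ Real.exp (-Real.pi * z.im)) (comap Complex.im atTop) (𝓝 0) := by
    refine (Real.tendsto_exp_neg_atTop_nhds_zero.comp
      (tendsto_comap.const_mul_atTop Real.pi_pos)).congr fun z ↦ ?_
    simp
  have h := (isBigO_at_im_infty_jacobiTheta_sub_one.trans_tendsto h0).add_const 1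
  simp only [sub_add_cancel, zero_add] at h
  exact h

/-- Translating by `1` or scaling by a positive real preserves the cusp `i∞`. -/
lemma tendsto_mul_add_comap_im {c : ℝ} (hc : 0 < c) (d : ℝ) :
    Tendsto (fun z : ℂ ↦ c * z + d) (comap Complex.im atTop) (comap Complex.im atTop) := by
  rw [tendsto_comap_iff]
  refine (tendsto_comap.const_mul_atTop hc).congr fun z ↦ ?_
  simp

lemma theta4_tendsto_one : Tendsto theta4 (comap Complex.im atTop) (𝓝 1) := by
  refine (theta3_tendsto_one.comp (tendsto_mul_add_comap_im one_pos 1)).congr fun z ↦ ?_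
  simp [← theta3_add_one]

lemma theta2_tendsto_zero : Tendsto theta2 (comap Complex.im atTop) (𝓝 0) := by
  have h := (theta3_tendsto_one.comp (tendsto_mul_add_comap_im (c := 1 / 4) (by norm_num) 0)).sub
    theta3_tendsto_one
  rw [sub_self] at h
  refine h.congr' ?_
  filter_upwards [preimage_mem_comap (Ioi_mem_atTop (0 : ℝ))] with z hz
  have := theta3_div_four hz
  simp only [Function.comp_apply, Complex.ofReal_div, Complex.ofReal_one, Complex.ofReal_ofNat,
    Complex.ofReal_zero, add_zero]
  rw [show 1 / 4 * z = z / 4 by ring, this]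
  ring

/-- Jacobi's identity `θ₃⁴ = θ₂⁴ + θ₄⁴`. -/
lemma theta3_pow_four {z : ℂ} (hz : 0 < z.im) : theta3 z ^ 4 = theta2 z ^ 4 + theta4 z ^ 4 := by
  have h := levelOne_eq_zero_of_tendsto_zero (k := 4)
    (f := fun z ↦ (theta3 z ^ 4 - theta2 z ^ 4 - theta4 z ^ 4) ^ 2) (by norm_num)
    (fun w hw ↦ ((((theta3_differentiableAt hw).pow 4).sub
      ((theta2_differentiableAt hw).pow 4)).sub ((theta4_differentiableAt hw).pow 4)).pow 2)
    (fun w _ ↦ by rw [theta3_add_one, theta4_add_one, theta2_add_one_pow_four]; ring)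
    (fun w hw ↦ by
      rw [theta3_neg_one_div_pow_four hw, theta4_neg_one_div_pow_four hw,
        theta2_neg_one_div_pow_four hw]
      norm_cast
      ring)
    (by simpa using (((theta3_tendsto_one.pow 4).sub (theta2_tendsto_zero.pow 4)).sub
      (theta4_tendsto_one.pow 4)).pow 2) z hz
  linear_combination pow_eq_zero_iff two_ne_zero |>.mp h

/-- Three holomorphic functions of weight `2` that are permuted by the generators of the modular
group and vanish at `i∞` are zero: their elementary symmetric functions are cusp forms of
weight less than `12`. -/
lemma eq_zero_of_permuted {f g h : ℂ → ℂ}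
    (hf : ∀ z : ℂ, 0 < z.im → DifferentiableAt ℂ f z)
    (hg : ∀ z : ℂ, 0 < z.im → DifferentiableAt ℂ g z)
    (hh : ∀ z : ℂ, 0 < z.im → DifferentiableAt ℂ h z)
    (fT : ∀ z, f (z + 1) = f z) (gT : ∀ z, g (z + 1) = h z) (hT : ∀ z, h (z + 1) = g z)
    (fS : ∀ z : ℂ, 0 < z.im → f (-1 / z) = z ^ 2 * g z)
    (gS : ∀ z : ℂ, 0 < z.im → g (-1 / z) = z ^ 2 * f z)
    (hS : ∀ z : ℂ, 0 < z.im → h (-1 / z) = z ^ 2 * h z)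
    (f0 : Tendsto f (comap Complex.im atTop) (𝓝 0))
    (g0 : Tendsto g (comap Complex.im atTop) (𝓝 0))
    (h0 : Tendsto h (comap Complex.im atTop) (𝓝 0)) {z : ℂ} (hz : 0 < z.im) :
    f z = 0 ∧ g z = 0 ∧ h z = 0 := by
  have h1 : f z + g z + h z = 0 :=
    levelOne_eq_zero_of_tendsto_zero (k := 2) (f := fun z ↦ f z + g z + h z) (by norm_num)
      (fun w hw ↦ ((hf w hw).add (hg w hw)).add (hh w hw))
      (fun w _ ↦ by rw [fT, gT, hT]; ring)
      (fun w hw ↦ by rw [fS w hw, gS w hw, hS w hw]; norm_cast; ring)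
      (by simpa using (f0.add g0).add h0) z hz
  have h2 : f z ^ 2 + g z ^ 2 + h z ^ 2 = 0 :=
    levelOne_eq_zero_of_tendsto_zero (k := 4) (f := fun z ↦ f z ^ 2 + g z ^ 2 + h z ^ 2)
      (by norm_num)
      (fun w hw ↦ (((hf w hw).pow 2).add ((hg w hw).pow 2)).add ((hh w hw).pow 2))
      (fun w _ ↦ by rw [fT, gT, hT]; ring)
      (fun w hw ↦ by rw [fS w hw, gS w hw, hS w hw]; norm_cast; ring)
      (by simpa using ((f0.pow 2).add (g0.pow 2)).add (h0.pow 2)) z hz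
  have h3 : f z * g z * h z = 0 :=
    levelOne_eq_zero_of_tendsto_zero (k := 6) (f := fun z ↦ f z * g z * h z) (by norm_num)
      (fun w hw ↦ ((hf w hw).mul (hg w hw)).mul (hh w hw))
      (fun w _ ↦ by rw [fT, gT, hT]; ring)
      (fun w hw ↦ by rw [fS w hw, gS w hw, hS w hw]; norm_cast; ring)
      (by simpa using (f0.mul g0).mul h0) z hz
  have h4 : f z * g z + f z * h z + g z * h z = 0 := by
    linear_combination (f z + g z + h z) / 2 * h1 - h2 / 2
  refine ⟨?_, ?_, ?_⟩ <;> refine (pow_eq_zero_iff three_ne_zero).mp ?_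
  · linear_combination f z ^ 2 * h1 - f z * h4 + h3
  · linear_combination g z ^ 2 * h1 - g z * h4 + h3
  · linear_combination h z ^ 2 * h1 - h z * h4 + h3

lemma E2_neg_one_div_add_one_div_two {z : ℂ} (hz : 0 < z.im) :
    E2 ((-1 / z + 1) / 2) = z ^ 2 * E2 ((z + 1) / 2) + 2 * (6 / (Real.pi * Complex.I)) * z := by
  have hu : 0 < ((z - 1) / 2).im := by simpa using hz
  have hz0 : z ≠ 0 := by rintro rfl; simp at hz
  have hz1 : z - 1 ≠ 0 := by intro h; simp [h] at hu
  set y : ℂ := -1 / ((z - 1) / 2) - 2 with hy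
  have hyz : y = -2 * z / (z - 1) := by rw [hy]; field_simp; ring
  have hyim : 0 < y.im := by simpa [hy] using im_neg_one_div_pos hu
  have h1 : E2 y = E2 (-1 / ((z - 1) / 2)) := by
    rw [← E2_add_one y, ← E2_add_one (y + 1), hy]
    congr 1; ring
  have h2 : E2 ((z - 1) / 2) = E2 ((z + 1) / 2) := by
    rw [← E2_add_one]
    congr 1; ring
  have h3 : (-1 / z + 1) / 2 = -1 / y := by rw [hyz]; field_simp; ring
  rw [h3, E2_neg_one_div hyim, h1, E2_neg_one_div hu, h2, hyz]
  have hp : (Real.pi : ℂ) ≠ 0 := by exact_mod_cast Real.pi_ne_zero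
  have hI := Complex.I_ne_zero
  field_simp
  ring

lemma E2_two_mul_and_half {z : ℂ} (hz : 0 < z.im) :
    4 * E2 (2 * z) - 2 * E2 z - (theta3 z ^ 4 + theta4 z ^ 4) = 0 ∧
    E2 (z / 2) - 2 * E2 z + (theta2 z ^ 4 + theta3 z ^ 4) = 0 ∧
    E2 ((z + 1) / 2) - 2 * E2 z + (theta4 z ^ 4 - theta2 z ^ 4) = 0 := by
  have d2 {w : ℂ} (hw : 0 < w.im) := (theta2_differentiableAt hw).pow 4
  have d3 {w : ℂ} (hw : 0 < w.im) := (theta3_differentiableAt hw).pow 4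
  have d4 {w : ℂ} (hw : 0 < w.im) := (theta4_differentiableAt hw).pow 4
  have dE {w : ℂ} (hw : 0 < w.im) := (E2_differentiableAt hw).const_mul 2
  have t2 := theta2_tendsto_zero.pow 4
  have t3 := theta3_tendsto_one.pow 4
  have t4 := theta4_tendsto_one.pow 4
  have tE := E2_tendsto_one.const_mul 2
  refine eq_zero_of_permuted
    (f := fun z ↦ 4 * E2 (2 * z) - 2 * E2 z - (theta3 z ^ 4 + theta4 z ^ 4))
    (g := fun z ↦ E2 (z / 2) - 2 * E2 z + (theta2 z ^ 4 + theta3 z ^ 4))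
    (h := fun z ↦ E2 ((z + 1) / 2) - 2 * E2 z + (theta4 z ^ 4 - theta2 z ^ 4))
    (fun w hw ↦ ?_) (fun w hw ↦ ?_) (fun w hw ↦ ?_) (fun w ↦ ?_) (fun w ↦ ?_) (fun w ↦ ?_)
    (fun w hw ↦ ?_) (fun w hw ↦ ?_) (fun w hw ↦ ?_) ?_ ?_ ?_ hz
  · have h : 0 < (2 * w).im := by simpa using hw
    exact ((((E2_differentiableAt h).comp w (f := fun w ↦ 2 * w) (by fun_prop)).const_mul 4).sub
      (dE hw)).sub ((d3 hw).add (d4 hw))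
  · have h : 0 < (w / 2).im := by simpa using hw
    exact (((E2_differentiableAt h).comp w (f := fun w ↦ w / 2) (by fun_prop)).sub
      (dE hw)).add ((d2 hw).add (d3 hw))
  · have h : 0 < ((w + 1) / 2).im := by simpa using hw
    exact (((E2_differentiableAt h).comp w (f := fun w ↦ (w + 1) / 2) (by fun_prop)).sub
      (dE hw)).add ((d4 hw).sub (d2 hw))
  · rw [show 2 * (w + 1) = 2 * w + 1 + 1 by ring, E2_add_one, E2_add_one, E2_add_one,
      theta3_add_one, theta4_add_one]
    ring
  · rw [E2_add_one, theta2_add_one_pow_four, theta3_add_one]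
    ring
  · rw [show (w + 1 + 1) / 2 = w / 2 + 1 by ring, E2_add_one, E2_add_one, theta4_add_one,
      theta2_add_one_pow_four]
    ring
  · have h : 0 < (w / 2).im := by simpa using hw
    rw [show 2 * (-1 / w) = -1 / (w / 2) by field_simp, E2_neg_one_div h, E2_neg_one_div hw,
      theta3_neg_one_div_pow_four hw, theta4_neg_one_div_pow_four hw]
    ring
  · have h : 0 < (2 * w).im := by simpa using hw
    rw [show -1 / w / 2 = -1 / (2 * w) by field_simp, E2_neg_one_div h, E2_neg_one_div hw,
      theta2_neg_one_div_pow_four hw, theta3_neg_one_div_pow_four hw]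
    ring
  · rw [E2_neg_one_div_add_one_div_two hw, E2_neg_one_div hw, theta2_neg_one_div_pow_four hw,
      theta4_neg_one_div_pow_four hw]
    ring
  · have h := E2_tendsto_one.comp (tendsto_mul_add_comap_im (c := 2) (by norm_num) 0)
    convert ((h.const_mul 4).sub tE).sub (t3.add t4) using 2 <;> norm_num
  · have h := E2_tendsto_one.comp (tendsto_mul_add_comap_im (c := 1 / 2) (by norm_num) 0)
    convert (h.sub tE).add (t2.add t3) using 2
    · simp [div_eq_inv_mul]
    · norm_num
  · have h := E2_tendsto_one.comp (tendsto_mul_add_comap_im (c := 1 / 2) (by norm_num) (1 / 2))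
    convert (h.sub tE).add (t4.sub t2) using 2
    · simp [div_eq_inv_mul, mul_add]
    · norm_num

/-- By Cauchy's estimate, a function tending to `a` at `i∞` has derivative tending to `0`. -/
lemma deriv_tendsto_zero {f : ℂ → ℂ} {a : ℂ}
    (hf : ∀ z : ℂ, 0 < z.im → DifferentiableAt ℂ f z)
    (h : Tendsto f (comap Complex.im atTop) (𝓝 a)) :
    Tendsto (deriv f) (comap Complex.im atTop) (𝓝 0) := by
  rw [Metric.tendsto_nhds] at h ⊢
  intro ε hε
  obtain ⟨t, ht, hts⟩ := mem_comap.mp (h (ε / 2) (half_pos hε))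
  obtain ⟨M, hM⟩ := mem_atTop_sets.mp ht
  filter_upwards [preimage_mem_comap (Ioi_mem_atTop (max M 0 + 1))] with z hz
  have him : ∀ w ∈ Metric.closedBall z 1, max M 0 < w.im := by
    intro w hw
    rw [mem_closedBall_iff_norm] at hw
    have h1 := (abs_le.mp ((Complex.abs_im_le_norm (w - z)).trans hw)).1
    rw [Complex.sub_im] at h1
    have h2 : max M 0 + 1 < z.im := hz
    linarith
  have hd : ∀ w ∈ Metric.closedBall z 1, DifferentiableAt ℂ (fun w ↦ f w - a) w :=
    fun w hw ↦ (hf w ((le_max_right _ _).trans_lt (him w hw))).sub_const a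
  have hc := Complex.norm_deriv_le_of_forall_mem_sphere_norm_le (f := fun w ↦ f w - a) (c := z)
    (R := 1) (C := ε / 2) one_pos
    (DifferentiableOn.diffContOnCl_ball (U := Metric.closedBall z 1)
      (fun w hw ↦ (hd w hw).differentiableWithinAt) subset_rfl)
    (fun w hw ↦ by
      rw [← dist_eq_norm]
      exact (hts (hM _ ((le_max_left M 0).trans
        (him w (Metric.sphere_subset_closedBall hw)).le))).le)
  rw [deriv_sub_const, div_one] at hc
  rw [dist_zero_right]
  linarith

/-- Ramanujan's differential equation for `E₂`, with `E₄ = (θ₂⁸ + θ₃⁸ + θ₄⁸) / 2`. -/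
lemma deriv_E2 {z : ℂ} (hz : 0 < z.im) :
    1 / (2 * Real.pi * Complex.I) * deriv E2 z =
      (E2 z ^ 2 - (theta2 z ^ 8 + theta3 z ^ 8 + theta4 z ^ 8) / 2) / 12 := by
  have hp : (Real.pi : ℂ) ≠ 0 := by exact_mod_cast Real.pi_ne_zero
  have hI := Complex.I_ne_zero
  have hS {w : ℂ} (hw : 0 < w.im) : deriv E2 (-1 / w) =
      w ^ 2 * (2 * w * E2 w + w ^ 2 * deriv E2 w + 6 / (Real.pi * Complex.I)) := by
    have hw0 : w ≠ 0 := by rintro rfl; simp at hw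
    have h1 : HasDerivAt (fun w ↦ E2 (-1 / w)) (deriv E2 (-1 / w) * (1 / w ^ 2)) w := by
      refine (E2_differentiableAt (im_neg_one_div_pos hw)).hasDerivAt.comp w
        (h := fun w ↦ -1 / w) ?_
      refine ((hasDerivAt_const w (-1 : ℂ)).div (hasDerivAt_id w) hw0).congr_deriv ?_
      simp
    have h2 : HasDerivAt (fun w ↦ w ^ 2 * E2 w + 6 / (Real.pi * Complex.I) * w)
        (2 * w * E2 w + w ^ 2 * deriv E2 w + 6 / (Real.pi * Complex.I)) w := by
      refine (((hasDerivAt_pow 2 w).mul (E2_differentiableAt hw).hasDerivAt).add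
        ((hasDerivAt_id w).const_mul (6 / (Real.pi * Complex.I)))).congr_deriv ?_
      simp
    have h3 : (fun w ↦ E2 (-1 / w)) =ᶠ[𝓝 w]
        fun w ↦ w ^ 2 * E2 w + 6 / (Real.pi * Complex.I) * w := by
      filter_upwards [isOpen_upperHalfPlaneSet.mem_nhds hw] with x hx using E2_neg_one_div hx
    rw [← h1.unique (h2.congr_of_eventuallyEq h3)]
    field_simp
  have hd {w : ℂ} (hw : 0 < w.im) : DifferentiableAt ℂ (deriv E2) w :=
    (DifferentiableOn.deriv (fun x hx ↦ (E2_differentiableAt hx).differentiableWithinAt)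
      isOpen_upperHalfPlaneSet).differentiableAt (isOpen_upperHalfPlaneSet.mem_nhds hw)
  have h := levelOne_eq_zero_of_tendsto_zero (k := 4)
    (f := fun z ↦ 1 / (2 * Real.pi * Complex.I) * deriv E2 z -
      (E2 z ^ 2 - ((theta2 z ^ 4) ^ 2 + (theta3 z ^ 4) ^ 2 + (theta4 z ^ 4) ^ 2) / 2) / 12)
    (by norm_num)
    (fun w hw ↦ ((hd hw).const_mul _).sub ((((E2_differentiableAt hw).pow 2).sub
      ((((((theta2_differentiableAt hw).pow 4).pow 2).add
        (((theta3_differentiableAt hw).pow 4).pow 2)).add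
        (((theta4_differentiableAt hw).pow 4).pow 2)).div_const 2)).div_const 12))
    (fun w _ ↦ by
      rw [← deriv_comp_add_const, funext E2_add_one, E2_add_one, theta2_add_one_pow_four,
        theta3_add_one, theta4_add_one]
      ring)
    (fun w hw ↦ by
      rw [hS hw, E2_neg_one_div hw, theta2_neg_one_div_pow_four hw,
        theta3_neg_one_div_pow_four hw, theta4_neg_one_div_pow_four hw, zpow_ofNat]
      field_simp
      ring)
    (by
      convert ((deriv_tendsto_zero (fun _ ↦ E2_differentiableAt) E2_tendsto_one).const_mul
        (1 / (2 * Real.pi * Complex.I))).sub (((E2_tendsto_one.pow 2).sub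
        (((((theta2_tendsto_zero.pow 4).pow 2).add ((theta3_tendsto_one.pow 4).pow 2)).add
        ((theta4_tendsto_one.pow 4).pow 2)).div_const 2)).div_const 12) using 1
      norm_num) z hz
  linear_combination h

lemma theta2_add_theta3_two_mul {z : ℂ} (hz : 0 < z.im) :
    theta2 (2 * z) ^ 4 + theta3 (2 * z) ^ 4 = (theta3 z ^ 4 + theta4 z ^ 4) / 2 := by
  have h1 := (E2_two_mul_and_half hz).1
  have h2 := (E2_two_mul_and_half (z := 2 * z) (by simpa using hz)).2.1
  rw [show 2 * z / 2 = z by ring] at h2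
  linear_combination h1 / 2 + h2

lemma theta_pow_eight_two_mul {z : ℂ} (hz : 0 < z.im) :
    theta2 (2 * z) ^ 8 + theta3 (2 * z) ^ 8 + theta4 (2 * z) ^ 8 =
      ((theta3 z ^ 4) ^ 2 + 14 * theta3 z ^ 4 * theta4 z ^ 4 + (theta4 z ^ 4) ^ 2) / 8 := by
  have hj := theta3_pow_four hz
  have hj2 := theta3_pow_four (z := 2 * z) (by simpa using hz)
  have hs := theta2_add_theta3_two_mul hz
  have hm : theta2 (2 * z) ^ 4 * theta3 (2 * z) ^ 4 = (theta3 z ^ 4 - theta4 z ^ 4) ^ 2 / 16 := by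
    rw [hj, add_sub_cancel_right, show theta2 z ^ 4 = (theta2 z ^ 2) ^ 2 by ring, theta2_sq hz]
    ring
  have hr : theta4 (2 * z) ^ 8 = (theta3 (2 * z) ^ 4 - theta2 (2 * z) ^ 4) ^ 2 := by
    rw [hj2]; ring
  rw [hr]
  linear_combination 2 * (theta2 (2 * z) ^ 4 + theta3 (2 * z) ^ 4 +
    (theta3 z ^ 4 + theta4 z ^ 4) / 2) * hs - 6 * hm

lemma theta_pow_eight_half {z : ℂ} (hz : 0 < z.im) :
    theta2 (z / 2) ^ 8 + theta3 (z / 2) ^ 8 + theta4 (z / 2) ^ 8 =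
      2 * ((theta2 z ^ 4) ^ 2 + 14 * theta2 z ^ 4 * theta3 z ^ 4 + (theta3 z ^ 4) ^ 2) := by
  have hz2 : 0 < (z / 2).im := by simpa using hz
  have hj := theta3_pow_four hz2
  have hs := theta2_add_theta3_two_mul hz2
  have hm := theta2_sq hz2
  rw [show 2 * (z / 2) = z by ring] at hs hm
  have hm8 : theta2 (z / 2) ^ 8 = 16 * theta2 z ^ 4 * theta3 z ^ 4 := by
    rw [show theta2 (z / 2) ^ 8 = (theta2 (z / 2) ^ 2) ^ 4 by ring, hm]
    ring
  linear_combination 3 / 2 * hm8 - 2 * (theta2 z ^ 4 + theta3 z ^ 4 +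
    (theta3 (z / 2) ^ 4 + theta4 (z / 2) ^ 4) / 2) * hs +
    (theta3 (z / 2) ^ 4 - theta4 (z / 2) ^ 4 + theta2 (z / 2) ^ 4) / 2 * hj

lemma theta_pow_eight_add_one_half {z : ℂ} (hz : 0 < z.im) :
    theta2 ((z + 1) / 2) ^ 8 + theta3 ((z + 1) / 2) ^ 8 + theta4 ((z + 1) / 2) ^ 8 =
      2 * ((theta2 z ^ 4) ^ 2 - 14 * theta2 z ^ 4 * theta4 z ^ 4 + (theta4 z ^ 4) ^ 2) := by
  rw [theta_pow_eight_half (z := z + 1) (by simpa using hz), theta2_add_one_pow_four,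
    theta3_add_one]
  ring

lemma Xcorr_eq {z : ℂ} (hz : 0 < z.im) : Xcorr z = theta2 z ^ 4 / 16 := by
  rw [Xcorr, Aform, Cform, show theta2 z ^ 4 = (theta2 z ^ 2) ^ 2 by ring, theta2_sq hz]
  ring

lemma Xcorr_eq_E2 {z : ℂ} (hz : 0 < z.im) :
    Xcorr z = (E2 ((z + 1) / 2) - E2 (z / 2)) / 48 := by
  obtain ⟨-, h2, h3⟩ := E2_two_mul_and_half hz
  rw [Xcorr_eq hz]
  linear_combination (h2 - h3 - theta3_pow_four hz) / 48

lemma Ycorr_eq {z : ℂ} (hz : 0 < z.im) : Ycorr z = -E2 (2 * z) / 4 := by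
  have hz2 : 0 < (2 * z).im := by simpa using hz
  obtain ⟨h1, h2, -⟩ := E2_two_mul_and_half hz2
  have hj := theta3_pow_four hz2
  rw [show 2 * z / 2 = z by ring] at h2
  rw [show 2 * (2 * z) = 4 * z by ring] at h1
  rw [Ycorr, Eform, Aform, Cform]
  linear_combination (-h1 + hj - h2) / 8

lemma Zcorr_eq {z : ℂ} (hz : 0 < z.im) : Zcorr z = (E2 (2 * z) - E2 z) / 12 := by
  have hz2 : 0 < (2 * z).im := by simpa using hz
  obtain ⟨h1, h2, -⟩ := E2_two_mul_and_half hz2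
  have hj := theta3_pow_four hz2
  rw [show 2 * z / 2 = z by ring] at h2
  rw [show 2 * (2 * z) = 4 * z by ring] at h1
  rw [Zcorr, Eform, Aform]
  linear_combination (-h1 + hj + h2) / 24

/-- The derivative of `E₂` along an affine map preserving the upper half-plane. -/
lemma hasDerivAt_E2_affine {m d z : ℂ} (h : 0 < (m * z + d).im) :
    HasDerivAt (fun w ↦ E2 (m * w + d)) (deriv E2 (m * z + d) * m) z := by
  refine (E2_differentiableAt h).hasDerivAt.comp z (h := fun w ↦ m * w + d) ?_
  simpa using ((hasDerivAt_id z).const_mul m).add_const d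

lemma deriv_Xcorr {z : ℂ} (hz : 0 < z.im) :
    deriv Xcorr z = (deriv E2 ((z + 1) / 2) - deriv E2 (z / 2)) / 96 := by
  have e1 (w : ℂ) : 1 / 2 * w + 1 / 2 = (w + 1) / 2 := by ring
  have e2 (w : ℂ) : 1 / 2 * w + 0 = w / 2 := by ring
  have h1 := hasDerivAt_E2_affine (m := 1 / 2) (d := 1 / 2) (z := z) (by simpa [e1] using hz)
  have h2 := hasDerivAt_E2_affine (m := 1 / 2) (d := 0) (z := z) (by simpa [e2] using hz)
  simp only [e1, e2] at h1 h2
  have h : Xcorr =ᶠ[𝓝 z] fun w ↦ (E2 ((w + 1) / 2) - E2 (w / 2)) / 48 := by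
    filter_upwards [isOpen_upperHalfPlaneSet.mem_nhds hz] with x hx using Xcorr_eq_E2 hx
  rw [h.deriv_eq, ((h1.fun_sub h2).div_const 48).deriv]
  ring

lemma deriv_Ycorr {z : ℂ} (hz : 0 < z.im) : deriv Ycorr z = -deriv E2 (2 * z) / 2 := by
  have h1 := hasDerivAt_E2_affine (m := 2) (d := 0) (z := z) (by simpa using hz)
  simp only [add_zero] at h1
  have h : Ycorr =ᶠ[𝓝 z] fun w ↦ -E2 (2 * w) / 4 := by
    filter_upwards [isOpen_upperHalfPlaneSet.mem_nhds hz] with x hx using Ycorr_eq hx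
  rw [h.deriv_eq, (h1.fun_neg.div_const 4).deriv]
  ring

lemma deriv_Zcorr {z : ℂ} (hz : 0 < z.im) :
    deriv Zcorr z = (2 * deriv E2 (2 * z) - deriv E2 z) / 12 := by
  have h1 := hasDerivAt_E2_affine (m := 2) (d := 0) (z := z) (by simpa using hz)
  simp only [add_zero] at h1
  have h : Zcorr =ᶠ[𝓝 z] fun w ↦ (E2 (2 * w) - E2 w) / 12 := by
    filter_upwards [isOpen_upperHalfPlaneSet.mem_nhds hz] with x hx using Zcorr_eq hx
  rw [h.deriv_eq, ((h1.fun_sub (E2_differentiableAt hz).hasDerivAt).div_const 12).deriv]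
  ring

end

theorem WDVV_system_P2222 (τ : ℂ) (hτ : 0 < τ.im) :
    2 * ((1 / (2 * Real.pi * Complex.I)) * deriv Xcorr τ) =
      4 * Xcorr τ * (Zcorr τ - Ycorr τ) ∧
    2 * ((1 / (2 * Real.pi * Complex.I)) * deriv Ycorr τ) =
      12 * Zcorr τ ^ 2 - 4 * Xcorr τ ^ 2 - 8 * Ycorr τ * Zcorr τ ∧
    2 * ((1 / (2 * Real.pi * Complex.I)) * deriv Zcorr τ) =
      4 * Xcorr τ ^ 2 - 4 * Zcorr τ ^ 2 := by
  have hd := deriv_E2 hτ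
  have hd2 := deriv_E2 (z := 2 * τ) (by simpa using hτ)
  have hdh := deriv_E2 (z := τ / 2) (by simpa using hτ)
  have hdk := deriv_E2 (z := (τ + 1) / 2) (by simpa using hτ)
  rw [theta_pow_eight_two_mul hτ] at hd2
  rw [theta_pow_eight_half hτ] at hdh
  rw [theta_pow_eight_add_one_half hτ] at hdk
  obtain ⟨h1, h2, h3⟩ := E2_two_mul_and_half hτ
  have e1 : E2 (2 * τ) = (2 * E2 τ + (theta3 τ ^ 4 + theta4 τ ^ 4)) / 4 := by
    linear_combination h1 / 4
  have e2 : E2 (τ / 2) = 2 * E2 τ - (theta2 τ ^ 4 + theta3 τ ^ 4) := by linear_combination h2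
  have e3 : E2 ((τ + 1) / 2) = 2 * E2 τ - (theta4 τ ^ 4 - theta2 τ ^ 4) := by
    linear_combination h3
  have e8 : theta2 τ ^ 8 + theta3 τ ^ 8 + theta4 τ ^ 8 =
      (theta2 τ ^ 4) ^ 2 + (theta3 τ ^ 4) ^ 2 + (theta4 τ ^ 4) ^ 2 := by ring
  rw [e8] at hd
  have hj : theta4 τ ^ 4 = theta3 τ ^ 4 - theta2 τ ^ 4 := by
    linear_combination -theta3_pow_four hτ
  rw [e1, hj] at hd2
  rw [hj] at hd
  rw [e2] at hdh
  rw [e3, hj] at hdk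
  rw [deriv_Xcorr hτ, deriv_Ycorr hτ, deriv_Zcorr hτ, Xcorr_eq hτ, Ycorr_eq hτ, Zcorr_eq hτ, e1,
    hj]
  refine ⟨?_, ?_, ?_⟩
  · linear_combination (hdk - hdh) / 48
  · linear_combination -hd2
  · linear_combination (2 * hd2 - hd) / 6
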